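/- arXiv:0902.0319 — 3 statements merged into one kernel-verified Lean document; each statement's English description precedes it below -/
import Mathlib

section
/- Let X be a locally compact metric space with group of isometries G. Let Γ = {g_i}_{i∈I} be a net in G and suppose there is a point x ∈ K(Γ) such that the net {g_i x} converges to some y ∈ X. Then there exist a subnet {g_j} of Γ and an isometry f : K(Γ) → X such that g_j converges to f pointwise on K(Γ). -/
/-!
STATEMENT 0: Let `X` be a locally compact metric space with group of isometries `G`
(the group of bijective self-isometries with the topology of pointwise convergence).
Let `Γ = {g_i}_{i ∈ I}` be a net in `G` and suppose there is `x ∈ K(Γ)` such that the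
net `{g_i x}` converges to some `y ∈ X`.  Then some subnet `{g_j}` of `Γ` converges
pointwise on `K(Γ)` to an isometry `f : K(Γ) → X`.
Here `K(F) = {x ∈ X : the orbit F·x has compact closure}`, and "some subnet converges
to `f`" is rendered as: `f` is a cluster point of the net (`MapClusterPt`), the target
space `K(Γ) → X` carrying the topology of pointwise convergence.
-/

open Filter Topology Metric

/-- The topology of pointwise convergence on the group of isometries of `X`
(for groups of isometries it coincides with the compact-open topology). -/
instance isometryGroupTopology (X : Type*) [MetricSpace X] : TopologicalSpace (X ≃ᵢ X) :=
  TopologicalSpace.induced (fun g : X ≃ᵢ X => (g : X → X)) Pi.topologicalSpace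

/-- `K(F)`: the set of points of `X` whose orbit under the family `F` of isometries
has compact closure. -/
def KSet {X : Type*} [MetricSpace X] (F : Set (X ≃ᵢ X)) : Set X :=
  {x : X | IsCompact (closure ((fun g : X ≃ᵢ X => g x) '' F))}

/-- The isometries form a closed set for the topology of pointwise convergence. -/
theorem isClosed_setOf_isometry (Y Z : Type*) [PseudoMetricSpace Y] [PseudoMetricSpace Z] :
    IsClosed {f : Y → Z | Isometry f} := by
  simp only [isometry_iff_dist_eq, Set.ofPred_forall]
  exact isClosed_iInter fun a => isClosed_iInter fun b =>
    isClosed_eq (by fun_prop) continuous_const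

theorem isometry_net_clusters_to_isometry_on_KSet
    {X : Type*} [MetricSpace X] [LocallyCompactSpace X]
    {I : Type*} [Nonempty I] [Preorder I] [IsDirected I (· ≤ ·)]
    (g : I → (X ≃ᵢ X)) (x y : X)
    (hx : x ∈ KSet (Set.range g))
    (hconv : Tendsto (fun i => g i x) atTop (𝓝 y)) :
    ∃ f : ↥(KSet (Set.range g)) → X, Isometry f ∧
      MapClusterPt f atTop (fun i (z : ↥(KSet (Set.range g))) => g i z) := by
  let K : Set (↥(KSet (Set.range g)) → X) :=
    Set.univ.pi fun z => closure ((fun h : X ≃ᵢ X => h z) '' Set.range g)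
  have hK : IsCompact (K ∩ {f | Isometry f}) :=
    (isCompact_univ_pi fun z => z.2).inter_right (isClosed_setOf_isometry _ _)
  have hmem : ∀ i, (fun z : ↥(KSet (Set.range g)) => g i z) ∈ K ∩ {f | Isometry f} := fun i =>
    ⟨fun _ _ => subset_closure ⟨g i, ⟨i, rfl⟩, rfl⟩, (g i).isometry.comp isometry_subtype_coe⟩
  obtain ⟨f, hf, hcluster⟩ :=
    hK.exists_mapClusterPt (f := atTop) (tendsto_principal.2 (.of_forall hmem))
  exact ⟨f, hf.2, hcluster⟩
end

section
/- Every connected locally compact metric space is pseudo-connected, i.e., it has exactly one pseudo-component. -/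
/-!
STATEMENT 11: Every connected locally compact metric space is pseudo-connected,
i.e. it has exactly one pseudo-component.
-/

open Metric

/-- `x` can be connected to `y` by a finite sequence of open balls, each with compact
closure, in which consecutive balls intersect, the first ball containing `x` and the
last one containing `y`. -/
def BallChain {X : Type*} [MetricSpace X] (x y : X) : Prop :=
  ∃ (n : ℕ) (c : Fin (n + 1) → X) (r : Fin (n + 1) → ℝ),
    (∀ i, 0 < r i) ∧
    (∀ i, IsCompact (closure (Metric.ball (c i) (r i)))) ∧
    x ∈ Metric.ball (c 0) (r 0) ∧
    y ∈ Metric.ball (c (Fin.last n)) (r (Fin.last n)) ∧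
    ∀ i : Fin n,
      (Metric.ball (c i.castSucc) (r i.castSucc) ∩ Metric.ball (c i.succ) (r i.succ)).Nonempty

/-- The pseudo-component of `x`. -/
def pseudoComponent {X : Type*} [MetricSpace X] (x : X) : Set X :=
  {y : X | BallChain x y ∧ BallChain y x}

namespace BallChain

variable {X : Type*} [MetricSpace X]

theorem of_mem_ball {x y p : X} {ρ : ℝ} (hρ : 0 < ρ)
    (hc : IsCompact (closure (Metric.ball p ρ))) (hx : x ∈ Metric.ball p ρ)
    (hy : y ∈ Metric.ball p ρ) : BallChain x y :=
  ⟨0, fun _ => p, fun _ => ρ, fun _ => hρ, fun _ => hc, hx, hy, fun i => i.elim0⟩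

theorem snoc {x y z p : X} {ρ : ℝ} (h : BallChain x z) (hρ : 0 < ρ)
    (hc : IsCompact (closure (Metric.ball p ρ))) (hz : z ∈ Metric.ball p ρ)
    (hy : y ∈ Metric.ball p ρ) : BallChain x y := by
  obtain ⟨n, c, r, hr, hcr, hx, hzl, hi⟩ := h
  refine ⟨n + 1, Fin.snoc (α := fun _ => X) c p, Fin.snoc (α := fun _ => ℝ) r ρ,
    ?_, ?_, ?_, ?_, ?_⟩
  · intro i
    induction i using Fin.lastCases with
    | last => simpa only [Fin.snoc_last] using hρ
    | cast i => simpa only [Fin.snoc_castSucc] using hr i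
  · intro i
    induction i using Fin.lastCases with
    | last => simpa only [Fin.snoc_last] using hc
    | cast i => simpa only [Fin.snoc_castSucc] using hcr i
  · rw [← Fin.castSucc_zero]
    simpa only [Fin.snoc_castSucc] using hx
  · simpa only [Fin.snoc_last] using hy
  · intro i
    induction i using Fin.lastCases with
    | last =>
      simp only [Fin.snoc_castSucc, Fin.succ_last, Fin.snoc_last]
      exact ⟨z, hzl, hz⟩
    | cast i =>
      simp only [Fin.succ_castSucc, Fin.snoc_castSucc]
      exact hi i

end BallChain

theorem exists_ball_isCompact_closure {X : Type*} [MetricSpace X] [LocallyCompactSpace X]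
    (x : X) : ∃ ρ : ℝ, 0 < ρ ∧ IsCompact (closure (Metric.ball x ρ)) := by
  obtain ⟨K, hK, hx⟩ := exists_compact_mem_nhds x
  obtain ⟨ρ, hρ, hsub⟩ := Metric.mem_nhds_iff.mp hx
  exact ⟨ρ, hρ, hK.closure_of_subset hsub⟩

theorem ballChain_of_preconnected {X : Type*} [MetricSpace X] [LocallyCompactSpace X]
    [PreconnectedSpace X] (x y : X) : BallChain x y := by
  have hclopen : IsClopen {z : X | BallChain x z} := by
    constructor
    · refine isClosed_of_closure_subset fun z hz => ?_
      obtain ⟨ρ, hρ, hc⟩ := exists_ball_isCompact_closure z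
      obtain ⟨w, hw, hzw⟩ := Metric.mem_closure_iff.mp hz ρ hρ
      exact BallChain.snoc hw hρ hc (Metric.mem_ball'.mpr hzw) (Metric.mem_ball_self hρ)
    · refine Metric.isOpen_iff.mpr fun z hz => ?_
      obtain ⟨ρ, hρ, hc⟩ := exists_ball_isCompact_closure z
      exact ⟨ρ, hρ, fun w hw => BallChain.snoc hz hρ hc (Metric.mem_ball_self hρ) hw⟩
  obtain ⟨ρ, hρ, hc⟩ := exists_ball_isCompact_closure x
  have huniv := hclopen.eq_univ
    ⟨x, BallChain.of_mem_ball hρ hc (Metric.mem_ball_self hρ) (Metric.mem_ball_self hρ)⟩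
  exact huniv.ge (Set.mem_univ y)

theorem pseudoConnected_of_connected
    (X : Type*) [MetricSpace X] [LocallyCompactSpace X] [ConnectedSpace X] :
    ∃ C : Set X, (Set.range fun x : X => pseudoComponent x) = {C} := by
  have huniv (x : X) : pseudoComponent x = Set.univ :=
    Set.eq_univ_of_forall fun y =>
      ⟨ballChain_of_preconnected x y, ballChain_of_preconnected y x⟩
  exact ⟨Set.univ, by simp only [huniv, Set.range_const]⟩
end

section
/- Let X be a locally compact metric space, let F be a set of bijective isometries of X onto itself, and let x ∈ X be such that the orbit F·x = {g x : g ∈ F} has compact closure in X. Then for every z ∈ X with d(z, x) < ρ(x), the orbit F·z also has compact closure in X. -/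
/-!
STATEMENT 12: Let `X` be a locally compact metric space, `F` a set of bijective
isometries of `X` onto itself, and `x ∈ X` such that the orbit `F·x = {g x : g ∈ F}`
has compact closure in `X`.  Then for every `z ∈ X` with `d(z, x) < ρ(x)`, the orbit
`F·z` also has compact closure in `X`.  Here `ρ(x) ∈ (0, ∞]` is the radius of
compactness, and the comparison `d(z, x) < ρ(x)` is made in `[0, ∞]` via `edist`.
-/

open Metric ENNReal

/-- The radius of compactness of a point of a metric space, with values in `[0, ∞]`:
the supremum of all radii `r > 0` such that the open ball `B_r(x)` has compact
closure. -/
noncomputable def radiusOfCompactness {X : Type*} [MetricSpace X] (x : X) : ℝ≥0∞ :=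
  ⨆ (r : ℝ) (_ : 0 < r ∧ IsCompact (closure (Metric.ball x r))), ENNReal.ofReal r

/-- Isometry equivalences preserve relative compactness of balls. -/
theorem IsometryEquiv.isCompact_closure_ball {X Y : Type*} [PseudoMetricSpace X]
    [PseudoMetricSpace Y] (g : X ≃ᵢ Y) {x : X} {r : ℝ}
    (h : IsCompact (closure (Metric.ball x r))) :
    IsCompact (closure (Metric.ball (g x) r)) := by
  rw [← g.image_ball, ← g.coe_toHomeomorph, ← g.toHomeomorph.image_closure]
  exact h.image g.toHomeomorph.continuous

theorem orbit_compactClosure_within_radiusOfCompactness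
    {X : Type*} [MetricSpace X] [LocallyCompactSpace X]
    (F : Set (X ≃ᵢ X)) (x : X)
    (hx : IsCompact (closure ((fun g : X ≃ᵢ X => g x) '' F)))
    (z : X) (hz : edist z x < radiusOfCompactness x) :
    IsCompact (closure ((fun g : X ≃ᵢ X => g z) '' F)) := by
  simp only [radiusOfCompactness, lt_iSup_iff] at hz
  obtain ⟨r, ⟨-, hr⟩, hzr⟩ := hz
  rw [edist_lt_ofReal] at hzr
  obtain ⟨t, htF, ht, hcover⟩ :=
    Metric.finite_approx_of_totallyBounded (hx.totallyBounded.subset subset_closure)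
      (r - dist z x) (sub_pos.2 hzr)
  have hK : IsCompact (⋃ y ∈ t, closure (Metric.ball y r)) := by
    refine ht.isCompact_biUnion fun y hy => ?_
    obtain ⟨h, -, rfl⟩ := htF hy
    exact h.isCompact_closure_ball hr
  refine hK.closure_of_subset ?_
  rintro _ ⟨g, hg, rfl⟩
  obtain ⟨y, hy, hgy⟩ := Set.mem_iUnion₂.1 (hcover (Set.mem_image_of_mem _ hg))
  refine Set.mem_iUnion₂.2 ⟨y, hy, subset_closure ?_⟩
  rw [Metric.mem_ball] at hgy ⊢
  calc dist (g z) y ≤ dist (g z) (g x) + dist (g x) y := dist_triangle _ _ _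
    _ < r := by rw [g.dist_eq]; linarith
end
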